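/- A positive integer m is represented by the quadratic form x^2 + 2y^2 + 2z^2 (i.e., there exist integers x, y, z with x^2 + 2y^2 + 2z^2 = m) if and only if m is not of the form 4^k(8ℓ + 7) for some nonnegative integers k and ℓ. -/

import Mathlib

open scoped NumberTheorySymbols in
theorem jacobiSym_neg_left_eq_flip {p d : ℕ} (hd : Odd d)
    (h : p % 4 = 1 ∨ (p % 4 = 3 ∧ d % 4 = 3)) : J(-(d : ℤ) | p) = J(p | d) := by
  have hp : Odd p := by rw [Nat.odd_iff]; omega
  rw [jacobiSym.neg _ hp]
  rcases h with h | ⟨h, h'⟩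
  · rw [ZMod.χ₄_nat_one_mod_four h, one_mul, jacobiSym.quadratic_reciprocity_one_mod_four' hd h]
  · rw [ZMod.χ₄_nat_three_mod_four h, jacobiSym.quadratic_reciprocity_three_mod_four h' h]
    ring

theorem exists_abs_two_mul_add_mul_le (a d : ℤ) (ha : 0 < a) :
    ∃ k : ℤ, -a ≤ 2 * (d + k * a) ∧ 2 * (d + k * a) ≤ a := by
  refine ⟨-((2 * d + a) / (2 * a)), ?_⟩
  have h₁ := Int.emod_add_mul_ediv (2 * d + a) (2 * a)
  have h₂ := Int.emod_nonneg (2 * d + a) (by omega : 2 * a ≠ 0)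
  have h₃ := Int.emod_lt_of_pos (2 * d + a) (by omega : 0 < 2 * a)
  constructor <;> nlinarith

/-- The ternary form with Gram matrix `!![a, d, e; d, b, f; e, f, c]` takes only values that are
sums of three squares. -/
def TernarySumSq (a b c d e f : ℤ) : Prop :=
  ∀ x y z : ℤ, ∃ u v w : ℤ,
    a * x ^ 2 + b * y ^ 2 + c * z ^ 2 + 2 * d * x * y + 2 * e * x * z + 2 * f * y * z =
      u ^ 2 + v ^ 2 + w ^ 2

theorem TernarySumSq.of_shift_fst {a b c d e f : ℤ} (k : ℤ)
    (h : TernarySumSq a (b + 2 * k * d + k ^ 2 * a) c (d + k * a) e (f + k * e)) :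
    TernarySumSq a b c d e f := by
  intro x y z
  obtain ⟨u, v, w, h⟩ := h (x - k * y) y z
  exact ⟨u, v, w, by rw [← h]; ring⟩

theorem TernarySumSq.of_shift_snd {a b c d e f : ℤ} (k : ℤ)
    (h : TernarySumSq a b (c + 2 * k * f + k ^ 2 * b) d (e + k * d) (f + k * b)) :
    TernarySumSq a b c d e f := by
  intro x y z
  obtain ⟨u, v, w, h⟩ := h x (y - k * z) z
  exact ⟨u, v, w, by rw [← h]; ring⟩

theorem TernarySumSq.of_swap_fst_snd {a b c d e f : ℤ} (h : TernarySumSq b a c d f e) :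
    TernarySumSq a b c d e f := by
  intro x y z
  obtain ⟨u, v, w, h⟩ := h y x z
  exact ⟨u, v, w, by rw [← h]; ring⟩

theorem TernarySumSq.of_swap_snd_trd {a b c d e f : ℤ} (h : TernarySumSq a c b e d f) :
    TernarySumSq a b c d e f := by
  intro x y z
  obtain ⟨u, v, w, h⟩ := h x z y
  exact ⟨u, v, w, by rw [← h]; ring⟩

/-- A positive definite integral ternary form of determinant one only represents sums of three
squares. -/
theorem TernarySumSq.of_det_eq_one (a b c d e f : ℤ) (ha : 0 < a) (hA : 0 < a * b - d ^ 2)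
    (hdet : a * b * c + 2 * d * e * f - a * f ^ 2 - b * e ^ 2 - c * d ^ 2 = 1) :
    TernarySumSq a b c d e f := by
  by_cases hred : 3 * (a * b - d ^ 2) ^ 2 ≤ 4 * a
  · obtain ⟨k, hk₁, hk₂⟩ := exists_abs_two_mul_add_mul_le a d ha
    apply TernarySumSq.of_shift_fst k
    have hA' : a * (b + 2 * k * d + k ^ 2 * a) - (d + k * a) ^ 2 = a * b - d ^ 2 := by ring
    have hdet' : a * (b + 2 * k * d + k ^ 2 * a) * c + 2 * (d + k * a) * e * (f + k * e)
        - a * (f + k * e) ^ 2 - (b + 2 * k * d + k ^ 2 * a) * e ^ 2 - c * (d + k * a) ^ 2 = 1 := by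
      rw [← hdet]; ring
    rw [← hA'] at hA hred
    generalize b + 2 * k * d + k ^ 2 * a = b' at *
    generalize d + k * a = d' at *
    generalize f + k * e = f' at *
    have hd : 4 * d' ^ 2 ≤ a ^ 2 := by nlinarith
    have hb : 0 < b' := by
      by_contra hb
      nlinarith [sq_nonneg d']
    by_cases hba : b' < a
    · apply TernarySumSq.of_swap_fst_snd
      exact TernarySumSq.of_det_eq_one b' a c d' f' e hb (by linarith) (by linarith)
    · have h₁ : 3 * a ^ 2 ≤ 4 * (a * b' - d' ^ 2) := by nlinarith
      have h₂ : (3 * a ^ 2) ^ 2 ≤ (4 * (a * b' - d' ^ 2)) ^ 2 :=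
        pow_le_pow_left₀ (by positivity) h₁ 2
      have ha1 : a = 1 := by
        by_contra hne
        have ha2 : 2 ≤ a := by omega
        have h₃ : a * 8 ≤ a * a ^ 3 :=
          mul_le_mul_of_nonneg_left (by nlinarith [pow_le_pow_left₀ (by norm_num) ha2 3]) ha.le
        nlinarith
      subst ha1
      have hd0 : d' = 0 := by omega
      subst hd0
      have hb1 : b' = 1 := by nlinarith
      subst hb1
      intro x y z
      refine ⟨x + e * z, y + f' * z, z, ?_⟩
      linear_combination z ^ 2 * hdet'
  · obtain ⟨k, hk₁, hk₂⟩ := exists_abs_two_mul_add_mul_le (a * b - d ^ 2) (a * f - d * e) hA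
    apply TernarySumSq.of_shift_snd k
    have hdet' : a * b * (c + 2 * k * f + k ^ 2 * b) + 2 * d * (e + k * d) * (f + k * b)
        - a * (f + k * b) ^ 2 - b * (e + k * d) ^ 2 - (c + 2 * k * f + k ^ 2 * b) * d ^ 2 = 1 := by
      rw [← hdet]; ring
    have hB : a * f - d * e + k * (a * b - d ^ 2) = a * (f + k * b) - d * (e + k * d) := by ring
    rw [hB] at hk₁ hk₂
    generalize c + 2 * k * f + k ^ 2 * b = c' at *
    generalize e + k * d = e' at *
    generalize f + k * b = f' at *
    have hmul : (a * c' - e' ^ 2) * (a * b - d ^ 2) = a + (a * f' - d * e') ^ 2 := by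
      linear_combination a * hdet'
    have hsq : 4 * (a * f' - d * e') ^ 2 ≤ (a * b - d ^ 2) ^ 2 := by nlinarith
    have hC : 0 < a * c' - e' ^ 2 := by
      by_contra hC
      nlinarith [sq_nonneg (a * f' - d * e')]
    have hlt : a * c' - e' ^ 2 < a * b - d ^ 2 := by
      by_contra hge
      nlinarith
    apply TernarySumSq.of_swap_snd_trd
    exact TernarySumSq.of_det_eq_one a c' b e' d f' ha hC (by linarith)
termination_by (a.toNat, (a * b - d ^ 2).toNat)
decreasing_by
  · apply Prod.Lex.left
    omega
  · apply Prod.Lex.right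
    omega

theorem exists_sum_three_sq_of_sq_add_eq_mul {n d x a : ℤ} (hd : 0 < d) (hdn : 0 < d * n - 1)
    (h : x ^ 2 + d = a * (d * n - 1)) : ∃ u v w : ℤ, n = u ^ 2 + v ^ 2 + w ^ 2 := by
  have ha : 0 < a := by
    by_contra ha
    nlinarith [sq_nonneg x]
  obtain ⟨u, v, w, h⟩ := TernarySumSq.of_det_eq_one a (d * n - 1) n x 1 0 ha (by linarith)
    (by linear_combination (-n) * h) 0 0 1
  exact ⟨u, v, w, by rw [← h]; ring⟩

open scoped NumberTheorySymbols in
theorem exists_dvd_sq_add_of_jacobiSym {p d : ℕ} (hp : p.Prime) (h : J(-(d : ℤ) | p) = 1) :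
    ∃ x : ℤ, (p : ℤ) ∣ x ^ 2 + d := by
  have := Fact.mk hp
  obtain ⟨r, hr⟩ := ZMod.isSquare_of_jacobiSym_eq_one h
  refine ⟨r.valMinAbs, (ZMod.intCast_zmod_eq_zero_iff_dvd _ p).mp ?_⟩
  push_cast [ZMod.coe_valMinAbs] at hr ⊢
  rw [sq, ← hr, neg_add_cancel]

open scoped NumberTheorySymbols in
theorem exists_sum_three_sq_of_mod_four_eq_two {n : ℕ} (hn : n % 4 = 2) :
    ∃ u v w : ℤ, (n : ℤ) = u ^ 2 + v ^ 2 + w ^ 2 := by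
  have hcop : IsCoprime ((n : ℤ) - 1) ((4 * n : ℕ) : ℤ) := by
    push_cast
    obtain ⟨t, ht⟩ : ∃ t : ℤ, (n : ℤ) = 4 * t + 2 := ⟨n / 4, by omega⟩
    refine IsCoprime.mul_right ?_ ⟨-1, 1, by ring⟩
    rw [ht]
    exact ⟨4 * t + 1, -(4 * t ^ 2 + 2 * t), by ring⟩
  obtain ⟨p, hpn, hp, hmod⟩ :=
    Nat.forall_exists_prime_gt_and_zmodEq n (by omega : 4 * n ≠ 0) hcop
  obtain ⟨j, hj⟩ := hmod.symm.dvd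
  push_cast at hj
  have hj0 : 0 ≤ j := by
    by_contra hneg
    nlinarith
  lift j to ℕ using hj0
  have hpd : (p : ℤ) = ((4 * j + 1 : ℕ) : ℤ) * n - 1 := by push_cast; linarith
  have hp4 : p % 4 = 1 := by
    have : (p : ℤ) = 4 * (n * j) + n - 1 := by linarith
    omega
  have hd : Odd (4 * j + 1) := ⟨2 * j, by ring⟩
  obtain ⟨x, a, hx⟩ := exists_dvd_sq_add_of_jacobiSym hp (d := 4 * j + 1) <| by
    rw [jacobiSym_neg_left_eq_flip hd (.inl hp4),
      jacobiSym.mod_left' (a₂ := -1) (Int.ModEq.symm (Int.modEq_iff_dvd.mpr ⟨n, by linarith⟩)),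
      jacobiSym.at_neg_one hd, ZMod.χ₄_nat_one_mod_four (by omega)]
  refine exists_sum_three_sq_of_sq_add_eq_mul (d := ((4 * j + 1 : ℕ) : ℤ)) (x := x) (a := a)
    (by positivity) ?_ ?_
  · rw [← hpd]; exact_mod_cast hp.pos
  · rw [← hpd, hx]; ring

open scoped NumberTheorySymbols in
theorem exists_sum_three_sq_of_two_mul_eq {n c s : ℕ} (hn : 0 < n) (hc : c = 1 ∨ c = 3)
    (hs : 2 * (s : ℤ) = c * n - 1) (hs4 : s % 4 = 1 ∨ s % 4 = 3 ∧ c = 3) :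
    ∃ u v w : ℤ, (n : ℤ) = u ^ 2 + v ^ 2 + w ^ 2 := by
  have hcop : IsCoprime (s : ℤ) ((4 * n : ℕ) : ℤ) := by
    push_cast
    refine IsCoprime.mul_right ?_ ⟨-2, c, by linarith⟩
    obtain ⟨t, ht⟩ : ∃ t : ℤ, (s : ℤ) = 2 * t + 1 := ⟨s / 2, by omega⟩
    rw [ht]
    exact ⟨2 * t + 1, -(t ^ 2 + t), by ring⟩
  obtain ⟨p, hpn, hp, hmod⟩ :=
    Nat.forall_exists_prime_gt_and_zmodEq s (by omega : 4 * n ≠ 0) hcop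
  obtain ⟨j, hj⟩ := hmod.symm.dvd
  push_cast at hj
  have hj0 : 0 ≤ j := by
    by_contra hneg
    nlinarith
  lift j to ℕ using hj0
  have hpd : 2 * (p : ℤ) = ((8 * j + c : ℕ) : ℤ) * n - 1 := by push_cast; linarith
  have hp4 : p % 4 = s % 4 := by
    have : (p : ℤ) = 4 * (n * j) + s := by linarith
    omega
  have hd : Odd (8 * j + c) := by rw [Nat.odd_iff]; omega
  obtain ⟨x, hx⟩ := exists_dvd_sq_add_of_jacobiSym hp (d := 8 * j + c) <| by
    rw [jacobiSym_neg_left_eq_flip hd (by omega)]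
    have h₁ : J(-2 | 8 * j + c) = 1 := by
      rw [jacobiSym.at_neg_two hd, ZMod.χ₈'_nat_eq_if_mod_eight, if_neg (by omega),
        if_pos (by omega)]
    have h₂ : J(-2 * (p : ℤ) | 8 * j + c) = 1 := by
      rw [jacobiSym.mod_left' (a₂ := 1), jacobiSym.one_left]
      exact Int.ModEq.symm (Int.modEq_iff_dvd.mpr ⟨-n, by linarith⟩)
    rwa [jacobiSym.mul_left, h₁, one_mul] at h₂
  have hp2 : (p : ℤ) % 2 = 1 := by omega
  obtain ⟨y, hy, hy2⟩ : ∃ y : ℤ, (p : ℤ) ∣ y ^ 2 + (8 * j + c : ℕ) ∧ y % 2 = 1 := by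
    rcases Int.emod_two_eq_zero_or_one x with h | h
    · refine ⟨x + p, ?_, by omega⟩
      have : (x + p) ^ 2 + ((8 * j + c : ℕ) : ℤ) = x ^ 2 + (8 * j + c : ℕ) + p * (2 * x + p) := by
        ring
      rw [this]
      exact dvd_add hx (dvd_mul_right _ _)
    · exact ⟨x, hx, h⟩
  have h2 : (2 : ℤ) ∣ y ^ 2 + (8 * j + c : ℕ) := by
    have hodd : Odd (y ^ 2) := (Int.odd_iff.mpr hy2).pow
    exact (hodd.add_odd (by exact_mod_cast hd)).two_dvd
  have hcop2 : IsCoprime (2 : ℤ) p := ⟨-(p / 2), 1, by omega⟩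
  obtain ⟨a, ha⟩ := hcop2.mul_dvd h2 hy
  refine exists_sum_three_sq_of_sq_add_eq_mul (d := ((8 * j + c : ℕ) : ℤ)) (x := y) (a := a)
    (by exact_mod_cast hd.pos) ?_ ?_
  · rw [← hpd]
    have := hp.pos
    positivity
  · rw [← hpd, ha]; ring

/-- The nontrivial direction of Legendre's three-square theorem. -/
theorem exists_sum_three_sq (n : ℕ) (hn : 0 < n)
    (h : ¬ ∃ k l : ℕ, (n : ℤ) = 4 ^ k * (8 * l + 7)) :
    ∃ u v w : ℤ, (n : ℤ) = u ^ 2 + v ^ 2 + w ^ 2 := by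
  induction n using Nat.strong_induction_on with
  | _ n ih =>
    by_cases h4 : n % 4 = 0
    · obtain ⟨m, rfl⟩ : ∃ m, n = 4 * m := ⟨n / 4, by omega⟩
      obtain ⟨u, v, w, hm⟩ := ih m (by omega) (by omega) <| by
        rintro ⟨k, l, hkl⟩
        exact h ⟨k + 1, l, by push_cast; rw [hkl]; ring⟩
      exact ⟨2 * u, 2 * v, 2 * w, by push_cast; rw [hm]; ring⟩
    have h7 : n % 8 ≠ 7 := fun h7 => h ⟨0, n / 8, by omega⟩
    by_cases h2 : n % 4 = 2
    · exact exists_sum_three_sq_of_mod_four_eq_two h2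
    by_cases h3 : n % 8 = 3
    · exact exists_sum_three_sq_of_two_mul_eq (c := 1) (s := (n - 1) / 2) hn (.inl rfl)
        (by omega) (by omega)
    · exact exists_sum_three_sq_of_two_mul_eq (c := 3) (s := (3 * n - 1) / 2) hn (.inr rfl)
        (by omega) (by omega)

/-- The easy direction of Legendre's three-square theorem. -/
theorem sum_three_sq_ne (k l : ℕ) (x y z : ℤ) :
    x ^ 2 + y ^ 2 + z ^ 2 ≠ 4 ^ k * (8 * l + 7) := by
  induction k generalizing x y z with
  | zero =>
    intro h
    have hsq : ∀ t : ℤ, t ^ 2 % 8 = 0 ∨ t ^ 2 % 8 = 1 ∨ t ^ 2 % 8 = 4 := by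
      intro t
      have : t % 8 = 0 ∨ t % 8 = 1 ∨ t % 8 = 2 ∨ t % 8 = 3 ∨ t % 8 = 4 ∨ t % 8 = 5 ∨ t % 8 = 6 ∨
        t % 8 = 7 := by omega
      rcases this with h | h | h | h | h | h | h | h <;> simp [pow_two, Int.mul_emod, h]
    have := hsq x
    have := hsq y
    have := hsq z
    omega
  | succ k ih =>
    intro h
    have hsq : ∀ t : ℤ, (t % 2 = 0 ∧ t ^ 2 % 4 = 0) ∨ (t % 2 = 1 ∧ t ^ 2 % 4 = 1) := by
      intro t
      rcases Int.emod_two_eq_zero_or_one t with ht | ht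
      · obtain ⟨s, rfl⟩ : ∃ s, t = 2 * s := ⟨t / 2, by omega⟩
        left
        ring_nf
        omega
      · obtain ⟨s, rfl⟩ : ∃ s, t = 2 * s + 1 := ⟨t / 2, by omega⟩
        right
        ring_nf
        omega
    rw [pow_succ (4 : ℤ), mul_right_comm] at h
    have := hsq x
    have := hsq y
    have := hsq z
    obtain ⟨x, rfl⟩ : ∃ s, x = 2 * s := ⟨x / 2, by omega⟩
    obtain ⟨y, rfl⟩ : ∃ s, y = 2 * s := ⟨y / 2, by omega⟩
    obtain ⟨z, rfl⟩ : ∃ s, z = 2 * s := ⟨z / 2, by omega⟩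
    exact ih x y z (by linarith)

theorem exists_sq_add_two_mul_sq_iff (m : ℤ) :
    (∃ x y z : ℤ, x ^ 2 + 2 * y ^ 2 + 2 * z ^ 2 = m) ↔
      ∃ u v w : ℤ, m = u ^ 2 + v ^ 2 + w ^ 2 := by
  constructor
  · rintro ⟨x, y, z, rfl⟩
    exact ⟨x, y + z, y - z, by ring⟩
  · have key : ∀ u v w : ℤ, (v + w) % 2 = 0 →
        ∃ x y z : ℤ, x ^ 2 + 2 * y ^ 2 + 2 * z ^ 2 = u ^ 2 + v ^ 2 + w ^ 2 := by
      intro u v w h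
      obtain ⟨s, hs⟩ : ∃ s, v = 2 * s - w := ⟨(v + w) / 2, by omega⟩
      exact ⟨u, s, s - w, by rw [hs]; ring⟩
    rintro ⟨u, v, w, rfl⟩
    have h : (v + w) % 2 = 0 ∨ (w + u) % 2 = 0 ∨ (u + v) % 2 = 0 := by omega
    rcases h with h | h | h
    · exact key u v w h
    · obtain ⟨x, y, z, e⟩ := key v w u h
      exact ⟨x, y, z, by rw [e]; ring⟩
    · obtain ⟨x, y, z, e⟩ := key w u v h
      exact ⟨x, y, z, by rw [e]; ring⟩

theorem rep_x2_2y2_2z2 (m : ℤ) (hm : 0 < m) :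
    (∃ x y z : ℤ, x ^ 2 + 2 * y ^ 2 + 2 * z ^ 2 = m) ↔
      ¬ ∃ k l : ℕ, m = 4 ^ k * (8 * l + 7) := by
  rw [exists_sq_add_two_mul_sq_iff]
  constructor
  · rintro ⟨u, v, w, h⟩ ⟨k, l, hkl⟩
    exact sum_three_sq_ne k l u v w (h.symm.trans hkl)
  · lift m to ℕ using hm.le
    exact exists_sum_three_sq m (by exact_mod_cast hm)
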